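/- (Compatibility of the conventional form of the recursion operator ℛ₁.) Let (u,v) be a smooth solution of the Pavlov–Mikhalev system on ℝ³ and let (φ^u, φ^v) be a symmetry generating function, i.e., a smooth solution of the linearized system. Then the two closedness identities ∂_y(u_xx·φ^u − u_x·∂_x(φ^u) − ∂_y(φ^u)) = ∂_x(u_xy·φ^u − u_y·∂_x(φ^u) − ∂_t(φ^u)) and ∂_y(v_xx·φ^u + 2·v_x·∂_x(φ^u) − 2·u_xx·φ^v − u_x·∂_x(φ^v) − ∂_y(φ^v)) = ∂_x(v_xy·φ^u + 2·v_y·∂_x(φ^u) − 2·u_xy·φ^v − u_y·∂_x(φ^v) − ∂_t(φ^v)) hold at every point of ℝ³; consequently the system D_x(φ̃^u) = u_xx·φ^u − u_x·D_x(φ^u) − D_y(φ^u), D_y(φ̃^u) = u_xy·φ^u − u_y·D_x(φ^u) − D_t(φ^u), D_x(φ̃^v) = v_xx·φ^u + 2·v_x·D_x(φ^u) − 2·u_xx·φ^v − u_x·D_x(φ^v) − D_y(φ^v), D_y(φ̃^v) = v_xy·φ^u + 2·v_y·D_x(φ^u) − 2·u_xy·φ^v − u_y·D_x(φ^v) − D_t(φ^v)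 defining the recursion operator ℛ₁ is compatible. -/

import Mathlib

noncomputable section

/-- Partial derivative with respect to the first coordinate `t`. -/
def Dt (f : ℝ → ℝ → ℝ → ℝ) : ℝ → ℝ → ℝ → ℝ := fun t x y => deriv (fun s => f s x y) t

/-- Partial derivative with respect to the second coordinate `x`. -/
def Dx (f : ℝ → ℝ → ℝ → ℝ) : ℝ → ℝ → ℝ → ℝ := fun t x y => deriv (fun s => f t s y) x

/-- Partial derivative with respect to the third coordinate `y`. -/
def Dy (f : ℝ → ℝ → ℝ → ℝ) : ℝ → ℝ → ℝ → ℝ := fun t x y => deriv (fun s => f t x s) y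

/-- `f` is a smooth function on `ℝ³` (given in curried form, coordinates `(t, x, y)`). -/
def Smooth3 (f : ℝ → ℝ → ℝ → ℝ) : Prop :=
  ContDiff ℝ (⊤ : ℕ∞) (fun p : ℝ × ℝ × ℝ => f p.1 p.2.1 p.2.2)

/-- The Pavlov–Mikhalev equation `u_yy = u_xt − u_x·u_xy + u_y·u_xx`. -/
def PMu (u : ℝ → ℝ → ℝ → ℝ) : Prop :=
  ∀ t x y : ℝ, Dy (Dy u) t x y =
    Dt (Dx u) t x y - Dx u t x y * Dy (Dx u) t x y + Dy u t x y * Dx (Dx u) t x y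

/-- The second equation of the two-component Pavlov–Mikhalev system:
`v_yy = v_xt − u_x·v_xy − 2·v_y·u_xx + 2·v_x·u_xy + u_y·v_xx`. -/
def PMv (u v : ℝ → ℝ → ℝ → ℝ) : Prop :=
  ∀ t x y : ℝ, Dy (Dy v) t x y =
    Dt (Dx v) t x y - Dx u t x y * Dy (Dx v) t x y
      - 2 * Dy v t x y * Dx (Dx u) t x y + 2 * Dx v t x y * Dy (Dx u) t x y
      + Dy u t x y * Dx (Dx v) t x y

/-- First equation of the linearized system applied to `A = φ^u`:
`φ^u_yy = φ^u_xt + u_xx·φ^u_y + u_y·φ^u_xx − u_x·φ^u_xy − u_xy·φ^u_x`. -/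
def LinU (u A : ℝ → ℝ → ℝ → ℝ) : Prop :=
  ∀ t x y : ℝ, Dy (Dy A) t x y =
    Dt (Dx A) t x y + Dx (Dx u) t x y * Dy A t x y + Dy u t x y * Dx (Dx A) t x y
      - Dx u t x y * Dy (Dx A) t x y - Dy (Dx u) t x y * Dx A t x y

/-- Second equation of the linearized system applied to `(A, B) = (φ^u, φ^v)`. -/
def LinV (u v A B : ℝ → ℝ → ℝ → ℝ) : Prop :=
  ∀ t x y : ℝ, Dy (Dy B) t x y =
    2 * Dx v t x y * Dy (Dx A) t x y - Dy (Dx v) t x y * Dx A t x y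
      + Dx (Dx v) t x y * Dy A t x y - 2 * Dy v t x y * Dx (Dx A) t x y
      + Dt (Dx B) t x y + 2 * Dy (Dx u) t x y * Dx B t x y
      - 2 * Dx (Dx u) t x y * Dy B t x y + Dy u t x y * Dx (Dx B) t x y
      - Dx u t x y * Dy (Dx B) t x y

/-- `(A,B)` is a symmetry generating function of the Pavlov–Mikhalev system over `(u,v)`. -/
def IsSymmetry (u v A B : ℝ → ℝ → ℝ → ℝ) : Prop := LinU u A ∧ LinV u v A B

/-- First equation of the tangent system over a solution `(u,v)`:
`p_yy = u_y·p_xx − u_xy·p_x − u_x·p_xy + u_xx·p_y + p_xt`. -/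
def TanP (u p : ℝ → ℝ → ℝ → ℝ) : Prop :=
  ∀ t x y : ℝ, Dy (Dy p) t x y =
    Dy u t x y * Dx (Dx p) t x y - Dy (Dx u) t x y * Dx p t x y
      - Dx u t x y * Dy (Dx p) t x y + Dx (Dx u) t x y * Dy p t x y + Dt (Dx p) t x y

/-- Second equation of the tangent system over a solution `(u,v)`:
`q_yy = 2·v_x·p_xy + v_xx·p_y − v_xy·p_x − 2·v_y·p_xx + 2·u_xy·q_x + u_y·q_xx
  − u_x·q_xy − 2·u_xx·q_y + q_xt`. -/
def TanQ (u v p q : ℝ → ℝ → ℝ → ℝ) : Prop :=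
  ∀ t x y : ℝ, Dy (Dy q) t x y =
    2 * Dx v t x y * Dy (Dx p) t x y + Dx (Dx v) t x y * Dy p t x y
      - Dy (Dx v) t x y * Dx p t x y - 2 * Dy v t x y * Dx (Dx p) t x y
      + 2 * Dy (Dx u) t x y * Dx q t x y + Dy u t x y * Dx (Dx q) t x y
      - Dx u t x y * Dy (Dx q) t x y - 2 * Dx (Dx u) t x y * Dy q t x y
      + Dt (Dx q) t x y


namespace Smooth3

variable {f : ℝ → ℝ → ℝ → ℝ}

theorem differentiable (hf : Smooth3 f) :
    Differentiable ℝ (fun p : ℝ × ℝ × ℝ => f p.1 p.2.1 p.2.2) :=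
  ContDiff.differentiable hf (by simp)

theorem hasDerivAt_fderiv_t (hf : Smooth3 f) (t x y : ℝ) :
    HasDerivAt (fun s => f s x y)
      (fderiv ℝ (fun p : ℝ × ℝ × ℝ => f p.1 p.2.1 p.2.2) (t, x, y) (1, 0, 0)) t :=
  (hf.differentiable (t, x, y)).hasFDerivAt.comp_hasDerivAt (f := fun s => (s, x, y)) t
    ((hasDerivAt_id t).prodMk ((hasDerivAt_const t x).prodMk (hasDerivAt_const t y)))

theorem hasDerivAt_fderiv_x (hf : Smooth3 f) (t x y : ℝ) :
    HasDerivAt (fun s => f t s y)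
      (fderiv ℝ (fun p : ℝ × ℝ × ℝ => f p.1 p.2.1 p.2.2) (t, x, y) (0, 1, 0)) x :=
  (hf.differentiable (t, x, y)).hasFDerivAt.comp_hasDerivAt (f := fun s => (t, s, y)) x
    ((hasDerivAt_const x t).prodMk ((hasDerivAt_id x).prodMk (hasDerivAt_const x y)))

theorem hasDerivAt_fderiv_y (hf : Smooth3 f) (t x y : ℝ) :
    HasDerivAt (fun s => f t x s)
      (fderiv ℝ (fun p : ℝ × ℝ × ℝ => f p.1 p.2.1 p.2.2) (t, x, y) (0, 0, 1)) y :=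
  (hf.differentiable (t, x, y)).hasFDerivAt.comp_hasDerivAt (f := fun s => (t, x, s)) y
    ((hasDerivAt_const y t).prodMk ((hasDerivAt_const y x).prodMk (hasDerivAt_id y)))

theorem hasDerivAt_x (hf : Smooth3 f) (t x y : ℝ) :
    HasDerivAt (fun s => f t s y) (Dx f t x y) x :=
  (hf.hasDerivAt_fderiv_x t x y).differentiableAt.hasDerivAt

theorem hasDerivAt_y (hf : Smooth3 f) (t x y : ℝ) :
    HasDerivAt (fun s => f t x s) (Dy f t x y) y :=
  (hf.hasDerivAt_fderiv_y t x y).differentiableAt.hasDerivAt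

theorem Dt_eq (hf : Smooth3 f) : Dt f = fun t x y =>
    fderiv ℝ (fun p : ℝ × ℝ × ℝ => f p.1 p.2.1 p.2.2) (t, x, y) (1, 0, 0) := by
  funext t x y
  exact (hf.hasDerivAt_fderiv_t t x y).deriv

theorem Dx_eq (hf : Smooth3 f) : Dx f = fun t x y =>
    fderiv ℝ (fun p : ℝ × ℝ × ℝ => f p.1 p.2.1 p.2.2) (t, x, y) (0, 1, 0) := by
  funext t x y
  exact (hf.hasDerivAt_fderiv_x t x y).deriv

theorem Dy_eq (hf : Smooth3 f) : Dy f = fun t x y =>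
    fderiv ℝ (fun p : ℝ × ℝ × ℝ => f p.1 p.2.1 p.2.2) (t, x, y) (0, 0, 1) := by
  funext t x y
  exact (hf.hasDerivAt_fderiv_y t x y).deriv

theorem fderiv_apply (hf : Smooth3 f) (w : ℝ × ℝ × ℝ) :
    Smooth3 fun t x y =>
      fderiv ℝ (fun p : ℝ × ℝ × ℝ => f p.1 p.2.1 p.2.2) (t, x, y) w :=
  (ContDiff.fderiv_right (m := (⊤ : ℕ∞)) hf (by simp)).clm_apply contDiff_const

theorem Dt (hf : Smooth3 f) : Smooth3 (Dt f) := hf.Dt_eq ▸ hf.fderiv_apply _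

theorem Dx (hf : Smooth3 f) : Smooth3 (Dx f) := hf.Dx_eq ▸ hf.fderiv_apply _

theorem Dy (hf : Smooth3 f) : Smooth3 (Dy f) := hf.Dy_eq ▸ hf.fderiv_apply _

theorem fderiv_fderiv_comm (hf : Smooth3 f) (p w z : ℝ × ℝ × ℝ) :
    fderiv ℝ (fun q => fderiv ℝ (fun p : ℝ × ℝ × ℝ => f p.1 p.2.1 p.2.2) q w) p z =
      fderiv ℝ (fun q => fderiv ℝ (fun p : ℝ × ℝ × ℝ => f p.1 p.2.1 p.2.2) q z) p w := by
  have hd : DifferentiableAt ℝ (fderiv ℝ (fun p : ℝ × ℝ × ℝ => f p.1 p.2.1 p.2.2)) p :=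
    (ContDiff.fderiv_right (m := (⊤ : ℕ∞)) hf (by simp)).differentiable (by simp) p
  have hs : IsSymmSndFDerivAt ℝ (fun p : ℝ × ℝ × ℝ => f p.1 p.2.1 p.2.2) p :=
    (ContDiff.contDiffAt hf).isSymmSndFDerivAt
      (by simpa using WithTop.coe_le_coe.mpr (le_top : (2 : ℕ∞) ≤ ⊤))
  rw [fderiv_clm_apply hd (by fun_prop), fderiv_clm_apply hd (by fun_prop)]
  simpa using hs z w

theorem Dx_Dy_comm (hf : Smooth3 f) (t x y : ℝ) :
    _root_.Dx (_root_.Dy f) t x y = _root_.Dy (_root_.Dx f) t x y := by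
  rw [hf.Dy.Dx_eq, hf.Dx.Dy_eq, hf.Dx_eq, hf.Dy_eq]
  exact hf.fderiv_fderiv_comm _ _ _

theorem Dx_Dt_comm (hf : Smooth3 f) (t x y : ℝ) :
    _root_.Dx (_root_.Dt f) t x y = _root_.Dt (_root_.Dx f) t x y := by
  rw [hf.Dt.Dx_eq, hf.Dx.Dt_eq, hf.Dx_eq, hf.Dt_eq]
  exact hf.fderiv_fderiv_comm _ _ _

end Smooth3

theorem recursion_R1_compatible (u v A B : ℝ → ℝ → ℝ → ℝ)
    (hu : Smooth3 u) (hv : Smooth3 v) (hA : Smooth3 A) (hB : Smooth3 B)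
    (hPMu : PMu u) (hPMv : PMv u v) (hLinU : LinU u A) (hLinV : LinV u v A B) :
    (∀ t x y : ℝ,
      Dy (fun t x y => Dx (Dx u) t x y * A t x y - Dx u t x y * Dx A t x y
        - Dy A t x y) t x y
      = Dx (fun t x y => Dy (Dx u) t x y * A t x y - Dy u t x y * Dx A t x y
        - Dt A t x y) t x y) ∧
    (∀ t x y : ℝ,
      Dy (fun t x y => Dx (Dx v) t x y * A t x y + 2 * Dx v t x y * Dx A t x y
        - 2 * Dx (Dx u) t x y * B t x y - Dx u t x y * Dx B t x y - Dy B t x y) t x y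
      = Dx (fun t x y => Dy (Dx v) t x y * A t x y + 2 * Dy v t x y * Dx A t x y
        - 2 * Dy (Dx u) t x y * B t x y - Dy u t x y * Dx B t x y - Dt B t x y) t x y) := by
  refine ⟨fun t x y => ?_, fun t x y => ?_⟩
  · have hl := ((hu.Dx.Dx.hasDerivAt_y t x y).fun_mul (hA.hasDerivAt_y t x y)).fun_sub
      ((hu.Dx.hasDerivAt_y t x y).fun_mul (hA.Dx.hasDerivAt_y t x y)) |>.fun_sub
      (hA.Dy.hasDerivAt_y t x y)
    have hr := ((hu.Dx.Dy.hasDerivAt_x t x y).fun_mul (hA.hasDerivAt_x t x y)).fun_sub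
      ((hu.Dy.hasDerivAt_x t x y).fun_mul (hA.Dx.hasDerivAt_x t x y)) |>.fun_sub
      (hA.Dt.hasDerivAt_x t x y)
    refine hl.deriv.trans (Eq.trans ?_ hr.deriv.symm)
    rw [hu.Dx.Dx_Dy_comm, hu.Dx_Dy_comm, hA.Dx_Dt_comm]
    linear_combination -hLinU t x y
  · have hl := ((hv.Dx.Dx.hasDerivAt_y t x y).fun_mul (hA.hasDerivAt_y t x y)).fun_add
      (((hv.Dx.hasDerivAt_y t x y).const_mul 2).fun_mul (hA.Dx.hasDerivAt_y t x y)) |>.fun_sub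
      (((hu.Dx.Dx.hasDerivAt_y t x y).const_mul 2).fun_mul (hB.hasDerivAt_y t x y)) |>.fun_sub
      ((hu.Dx.hasDerivAt_y t x y).fun_mul (hB.Dx.hasDerivAt_y t x y)) |>.fun_sub
      (hB.Dy.hasDerivAt_y t x y)
    have hr := ((hv.Dx.Dy.hasDerivAt_x t x y).fun_mul (hA.hasDerivAt_x t x y)).fun_add
      (((hv.Dy.hasDerivAt_x t x y).const_mul 2).fun_mul (hA.Dx.hasDerivAt_x t x y)) |>.fun_sub
      (((hu.Dx.Dy.hasDerivAt_x t x y).const_mul 2).fun_mul (hB.hasDerivAt_x t x y)) |>.fun_sub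
      ((hu.Dy.hasDerivAt_x t x y).fun_mul (hB.Dx.hasDerivAt_x t x y)) |>.fun_sub
      (hB.Dt.hasDerivAt_x t x y)
    refine hl.deriv.trans (Eq.trans ?_ hr.deriv.symm)
    rw [hv.Dx.Dx_Dy_comm, hv.Dx_Dy_comm, hu.Dx.Dx_Dy_comm, hu.Dx_Dy_comm, hB.Dx_Dt_comm]
    linear_combination -hLinV t x y
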